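/- Let q ≥ 1 be an integer and define K^rw: ℕ × ℕ → ℝ by K^rw(r,t) = (q/(q+1))^t · Σ_{k=0}^{t} C(t,k) · (−1)^k · ( q^{−r/2} · I_r^{−2/√q}(k) − (q−1) · Σ_{j=1}^{⌊(k−r)/2⌋} q^{−(r+2j)/2} · I_{r+2j}^{−2/√q}(k) ), where C(t,k) is the binomial coefficient. Then K^rw(0,0)=1 and K^rw(r,0)=0 for r ≥ 1; K^rw(0,t+1) = K^rw(1,t) for all t ≥ 0; and K^rw(r,t+1) = (q·K^rw(r+1,t) + K^rw(r−1,t))/(q+1) for all r ≥ 1 and t ≥ 0. (Thus K^rw(r,t) is the probability that the uniform random walk on the (q+1)-regular tree started at the base point is at a given vertex at radial distance r after t steps.) -/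

import Mathlib

open Finset

/-- The discrete `I`-Bessel function `I_n^c(t)` (real parameter `c`). -/
noncomputable def besselI (c : ℝ) (n t : ℕ) : ℝ :=
  if n ≤ t then
    ∑ j ∈ Finset.range ((t - n) / 2 + 1),
      (t.factorial : ℝ) /
          ((j.factorial : ℝ) * ((t - 2 * j - n).factorial : ℝ) * ((n + j).factorial : ℝ)) *
        (c / 2) ^ (2 * j + n)
  else 0

/-- The random walk heat kernel on the `(q+1)`-regular tree as a function of the radial
distance `r` and time `t`. -/
noncomputable def KrwTree (q : ℕ) (r t : ℕ) : ℝ :=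
  ((q : ℝ) / ((q : ℝ) + 1)) ^ t * ∑ k ∈ Finset.range (t + 1),
    (t.choose k : ℝ) * (-1 : ℝ) ^ k *
      (((Real.sqrt q) ^ r)⁻¹ * besselI (-2 / Real.sqrt q) r k -
        ((q : ℝ) - 1) * ∑ j ∈ Finset.Icc 1 ((k - r) / 2),
          ((Real.sqrt q) ^ (r + 2 * j))⁻¹ * besselI (-2 / Real.sqrt q) (r + 2 * j) k)

/-- A single sum in binomial coefficients, of any sufficient length, gives `besselI`. -/
theorem besselI_eq_sum (c : ℝ) (n t N : ℕ) (h : t < 2 * N + n) :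
    besselI c n t = ∑ j ∈ range N,
      (t.choose (2 * j + n) : ℝ) * ((2 * j + n).choose j : ℝ) * (c / 2) ^ (2 * j + n) := by
  unfold besselI
  split_ifs with hn
  · refine (sum_congr rfl fun j hj => ?_).trans (sum_subset ?_ ?_)
    · have hj' : 2 * j + n ≤ t := by
        have := mem_range.1 hj
        omega
      rw [Nat.cast_choose ℝ hj', Nat.cast_choose ℝ (show j ≤ 2 * j + n by omega),
        show 2 * j + n - j = n + j by omega, show t - (2 * j + n) = t - 2 * j - n by omega]
      have := Nat.cast_ne_zero (R := ℝ).2 (2 * j + n).factorial_ne_zero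
      field_simp
    · intro j hj
      simp only [mem_range] at *
      omega
    · intro j _ hj
      rw [Nat.choose_eq_zero_of_lt (by simp only [mem_range] at *; omega)]
      simp
  · symm
    refine sum_eq_zero fun j _ => ?_
    rw [Nat.choose_eq_zero_of_lt (by omega)]
    simp

theorem besselI_of_lt (c : ℝ) {n t : ℕ} (h : t < n) : besselI c n t = 0 :=
  if_neg (by omega)

theorem besselI_succ_succ (c : ℝ) (n t : ℕ) :
    besselI c (n + 1) (t + 1) =
      besselI c (n + 1) t + c / 2 * (besselI c n t + besselI c (n + 2) t) := by
  rw [besselI_eq_sum c (n + 1) (t + 1) (t + 2) (by omega),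
    besselI_eq_sum c (n + 1) t (t + 2) (by omega),
    besselI_eq_sum c n t (t + 2) (by omega), besselI_eq_sum c (n + 2) t (t + 1) (by omega),
    sum_range_succ' _ (t + 1), sum_range_succ' _ (t + 1), sum_range_succ' _ (t + 1)]
  have key : ∀ j : ℕ,
      ((t + 1).choose (2 * (j + 1) + (n + 1)) : ℝ) * ((2 * (j + 1) + (n + 1)).choose (j + 1) : ℝ) *
          (c / 2) ^ (2 * (j + 1) + (n + 1)) =
        (t.choose (2 * (j + 1) + (n + 1)) : ℝ) * ((2 * (j + 1) + (n + 1)).choose (j + 1) : ℝ) *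
          (c / 2) ^ (2 * (j + 1) + (n + 1)) +
        c / 2 * ((t.choose (2 * (j + 1) + n) : ℝ) * ((2 * (j + 1) + n).choose (j + 1) : ℝ) *
          (c / 2) ^ (2 * (j + 1) + n)) +
        c / 2 * ((t.choose (2 * j + (n + 2)) : ℝ) * ((2 * j + (n + 2)).choose j : ℝ) *
          (c / 2) ^ (2 * j + (n + 2))) := by
    intro j
    rw [show 2 * (j + 1) + (n + 1) = (2 * j + n + 2) + 1 by ring,
      show 2 * (j + 1) + n = 2 * j + n + 2 by ring,
      show 2 * j + (n + 2) = 2 * j + n + 2 by ring,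
      Nat.choose_succ_succ' t, Nat.choose_succ_succ' (2 * j + n + 2) j]
    push_cast
    ring
  rw [sum_congr rfl fun j _ => key j]
  simp only [sum_add_distrib, ← mul_sum]
  simp only [mul_zero, zero_add, Nat.choose_zero_right, Nat.choose_succ_succ' t n]
  push_cast
  ring

theorem besselI_zero_succ (c : ℝ) (t : ℕ) :
    besselI c 0 (t + 1) = besselI c 0 t + c * besselI c 1 t := by
  rw [besselI_eq_sum c 0 (t + 1) (t + 2) (by omega),
    besselI_eq_sum c 0 t (t + 2) (by omega),
    besselI_eq_sum c 1 t (t + 1) (by omega),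
    sum_range_succ' _ (t + 1), sum_range_succ' _ (t + 1), mul_sum, add_right_comm,
    ← sum_add_distrib]
  congr 1
  · refine sum_congr rfl fun j _ => ?_
    have h : (2 * j + 1).choose (j + 1) = (2 * j + 1).choose j :=
      Nat.choose_symm_of_eq_add (by ring)
    rw [show 2 * (j + 1) + 0 = 2 * j + 1 + 1 by ring, Nat.choose_succ_succ' t,
      Nat.choose_succ_succ' (2 * j + 1) j, h]
    push_cast
    ring
  · simp

/-- The term of order `n` in the heat kernel of the `(q+1)`-regular tree. -/
noncomputable def treeTerm (q n k : ℕ) : ℝ :=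
  ((Real.sqrt q) ^ n)⁻¹ * besselI (-2 / Real.sqrt q) n k

theorem treeTerm_of_lt (q : ℕ) {n k : ℕ} (h : k < n) : treeTerm q n k = 0 := by
  rw [treeTerm, besselI_of_lt _ h, mul_zero]

theorem treeTerm_succ_succ {q : ℕ} (hq : 1 ≤ q) (n k : ℕ) :
    treeTerm q (n + 1) (k + 1) =
      treeTerm q (n + 1) k - treeTerm q n k / q - treeTerm q (n + 2) k := by
  have hs : Real.sqrt q ≠ 0 := (Real.sqrt_pos.2 (by exact_mod_cast hq)).ne'
  have hq' : (q : ℝ) = Real.sqrt q ^ 2 := (Real.sq_sqrt q.cast_nonneg).symm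
  simp only [treeTerm, besselI_succ_succ]
  field_simp
  rw [hq', Real.sqrt_sq (Real.sqrt_nonneg _)]
  ring

theorem treeTerm_zero_succ {q : ℕ} (hq : 1 ≤ q) (k : ℕ) :
    treeTerm q 0 (k + 1) = treeTerm q 0 k - 2 * treeTerm q 1 k := by
  have hs : Real.sqrt q ≠ 0 := (Real.sqrt_pos.2 (by exact_mod_cast hq)).ne'
  simp only [treeTerm, besselI_zero_succ]
  field_simp
  ring

/-- The heat kernel `KrwTree q r` is, up to a power of `q / (q + 1)`, the binomial transform
of `treeKernel q r`. -/
noncomputable def treeKernel (q r k : ℕ) : ℝ :=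
  treeTerm q r k - ((q : ℝ) - 1) * ∑ j ∈ Icc 1 ((k - r) / 2), treeTerm q (r + 2 * j) k

theorem treeKernel_eq (q r k N : ℕ) (h : k < 2 * N + r + 2) :
    treeKernel q r k =
      treeTerm q r k - ((q : ℝ) - 1) * ∑ j ∈ range N, treeTerm q (r + 2 * j + 2) k := by
  unfold treeKernel
  congr 2
  rw [range_eq_Ico]
  refine Eq.trans ?_ (sum_Ico_add' (fun j => treeTerm q (r + 2 * j) k) 0 N 1).symm
  refine sum_subset ?_ ?_
  · intro j hj
    simp only [mem_Icc, mem_Ico] at *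
    omega
  · intro j hj hj'
    refine treeTerm_of_lt q ?_
    simp only [mem_Icc, mem_Ico] at *
    omega

theorem treeKernel_succ_succ {q : ℕ} (hq : 1 ≤ q) (r k : ℕ) :
    treeKernel q (r + 1) (k + 1) =
      treeKernel q (r + 1) k - treeKernel q r k / q - treeKernel q (r + 2) k := by
  rw [treeKernel_eq q (r + 1) (k + 1) (k + 1) (by omega),
    treeKernel_eq q (r + 1) k (k + 1) (by omega),
    treeKernel_eq q r k (k + 1) (by omega), treeKernel_eq q (r + 2) k (k + 1) (by omega),
    treeTerm_succ_succ hq]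
  have key : ∀ j : ℕ, treeTerm q (r + 1 + 2 * j + 2) (k + 1) =
      treeTerm q (r + 1 + 2 * j + 2) k - treeTerm q (r + 2 * j + 2) k / q -
        treeTerm q (r + 2 + 2 * j + 2) k := by
    intro j
    have := treeTerm_succ_succ hq (r + 2 * j + 2) k
    rwa [show r + 2 * j + 2 + 1 = r + 1 + 2 * j + 2 by ring,
      show r + 2 * j + 2 + 2 = r + 2 + 2 * j + 2 by ring] at this
  rw [sum_congr rfl fun j _ => key j, sum_sub_distrib, sum_sub_distrib, ← sum_div]
  ring

theorem treeKernel_zero_succ {q : ℕ} (hq : 1 ≤ q) (k : ℕ) :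
    treeKernel q 0 (k + 1) =
      treeKernel q 0 k - ((q : ℝ) + 1) / q * treeKernel q 1 k := by
  have hq0 : (q : ℝ) ≠ 0 := by exact_mod_cast (by omega : q ≠ 0)
  rw [treeKernel_eq q 0 (k + 1) (k + 1) (by omega),
    treeKernel_eq q 0 k (k + 1) (by omega), treeKernel_eq q 1 k (k + 1) (by omega),
    treeTerm_zero_succ hq]
  have key : ∀ j : ℕ, treeTerm q (0 + 2 * j + 2) (k + 1) =
      treeTerm q (0 + 2 * j + 2) k - treeTerm q (2 * j + 1) k / q -
        treeTerm q (1 + 2 * j + 2) k := by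
    intro j
    have := treeTerm_succ_succ hq (2 * j + 1) k
    rwa [show 2 * j + 1 + 1 = 0 + 2 * j + 2 by ring,
      show 2 * j + 1 + 2 = 1 + 2 * j + 2 by ring] at this
  have shift : ∑ j ∈ range (k + 1), treeTerm q (2 * j + 1) k =
      treeTerm q 1 k + ∑ j ∈ range (k + 1), treeTerm q (1 + 2 * j + 2) k := by
    have h := sum_range_succ (fun j => treeTerm q (2 * j + 1) k) (k + 1)
    rw [sum_range_succ' _ (k + 1), treeTerm_of_lt q (n := 2 * (k + 1) + 1) (by omega)] at h
    rw [add_zero] at h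
    rw [← h, add_comm]
    congr 1
    exact sum_congr rfl fun j _ => by rw [show 1 + 2 * j + 2 = 2 * (j + 1) + 1 by ring]
  rw [sum_congr rfl fun j _ => key j, sum_sub_distrib, sum_sub_distrib, ← sum_div, shift]
  field_simp
  ring

/-- The binomial transform turns a backward difference into a shift. -/
theorem sum_choose_neg_one_pow_succ (f : ℕ → ℝ) (t : ℕ) :
    ∑ k ∈ range (t + 2), ((t + 1).choose k : ℝ) * (-1) ^ k * f k =
      ∑ k ∈ range (t + 1), (t.choose k : ℝ) * (-1) ^ k * (f k - f (k + 1)) := by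
  have h := sum_range_succ (fun k => (t.choose k : ℝ) * (-1) ^ k * f k) (t + 1)
  rw [sum_range_succ' _ (t + 1), Nat.choose_succ_self] at h
  rw [sum_range_succ' _ (t + 1)]
  simp only [Nat.choose_succ_succ' t, mul_sub, sum_sub_distrib]
  simp only [Nat.cast_add, add_mul, sum_add_distrib, pow_succ, Nat.choose_zero_right] at h ⊢
  simp only [Nat.cast_zero, zero_mul, add_zero] at h
  rw [← h]
  simp only [mul_neg, neg_mul, mul_one, sum_neg_distrib]
  ring

theorem KrwTree_eq (q r t : ℕ) :
    KrwTree q r t = ((q : ℝ) / ((q : ℝ) + 1)) ^ t *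
      ∑ k ∈ range (t + 1), (t.choose k : ℝ) * (-1) ^ k * treeKernel q r k := rfl

theorem stmt17 (q : ℕ) (hq : 1 ≤ q) :
    (KrwTree q 0 0 = 1 ∧ ∀ r : ℕ, 1 ≤ r → KrwTree q r 0 = 0) ∧
    (∀ t : ℕ, KrwTree q 0 (t + 1) = KrwTree q 1 t) ∧
    (∀ r t : ℕ, 1 ≤ r → KrwTree q r (t + 1) =
      ((q : ℝ) * KrwTree q (r + 1) t + KrwTree q (r - 1) t) / ((q : ℝ) + 1)) := by
  have hq0 : (q : ℝ) ≠ 0 := by exact_mod_cast (by omega : q ≠ 0)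
  have hq1 : (q : ℝ) + 1 ≠ 0 := by positivity
  refine ⟨⟨by simp [KrwTree, besselI], fun r hr => ?_⟩, fun t => ?_, fun r t hr => ?_⟩
  · have h0 : ¬ r = 0 := by omega
    simp [KrwTree, besselI, h0]
  · rw [KrwTree_eq, KrwTree_eq, sum_choose_neg_one_pow_succ, pow_succ, mul_assoc, mul_sum]
    congr 1
    refine sum_congr rfl fun k _ => ?_
    rw [treeKernel_zero_succ hq]
    field_simp
    ring
  · obtain ⟨r, rfl⟩ := Nat.exists_eq_add_of_le' hr
    have h : ∀ k, (t.choose k : ℝ) * (-1) ^ k *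
        (treeKernel q (r + 1) k - treeKernel q (r + 1) (k + 1)) =
        (t.choose k : ℝ) * (-1) ^ k * treeKernel q (r + 2) k +
          (t.choose k : ℝ) * (-1) ^ k * treeKernel q r k / q := fun k => by
      rw [treeKernel_succ_succ hq]
      ring
    rw [KrwTree_eq, KrwTree_eq, KrwTree_eq, sum_choose_neg_one_pow_succ, Nat.add_sub_cancel,
      sum_congr rfl fun k _ => h k, sum_add_distrib, ← sum_div, pow_succ]
    field_simp
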